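/- arXiv:1105.0455 — 2 statements merged into one kernel-verified Lean document; each statement's English description precedes it below -/
import Mathlib

section
/- Let μ > 0, λ > 0 and set λ̃ = λ/μ. For every real ξ̃ with 0 < ξ̃ < 1, one has φ(iξ̃) = 0 if and only if ψ(ξ̃²) = 0, where ψ(σ) = (1−σ)(1−σ/(2+λ̃)) − (1−σ/2)⁴. -/
/-- The principal branch of the complex square root:
with `-π < arg z ≤ π`, `arg (csqrt z) = (1/2) * arg z`. -/
noncomputable def csqrt (z : ℂ) : ℂ := z ^ ((1 : ℂ) / 2)

/-- The determinant function `φ(s̃) = √(1+s̃²)·√(1+μs̃²/(λ+2μ)) − (1+s̃²/2)²`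
for Lamé parameters `μ > 0`, `λ > 0`. -/
noncomputable def phi (μ lam : ℝ) (s : ℂ) : ℂ :=
  csqrt (1 + s ^ 2) * csqrt (1 + (μ : ℂ) * s ^ 2 / ((lam : ℂ) + 2 * (μ : ℂ)))
    - (1 + s ^ 2 / 2) ^ 2

/-- For a real parameter `λ̃ ≥ 0` (representing λ/μ), the function
`ψ(σ) = (1−σ)(1−σ/(2+λ̃)) − (1−σ/2)⁴`. -/
noncomputable def psi (lamTilde : ℝ) (σ : ℝ) : ℝ :=
  (1 - σ) * (1 - σ / (2 + lamTilde)) - (1 - σ / 2) ^ 4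

theorem csqrt_ofReal_of_nonneg {x : ℝ} (hx : 0 ≤ x) : csqrt (x : ℂ) = (√x : ℝ) := by
  rw [csqrt, Real.sqrt_eq_rpow, Complex.ofReal_cpow hx]
  norm_num

theorem phi_I_mul_ofReal {μ lam ξ : ℝ} (hξ : 0 ≤ 1 - ξ ^ 2)
    (hξ' : 0 ≤ 1 - μ * ξ ^ 2 / (lam + 2 * μ)) :
    phi μ lam (Complex.I * (ξ : ℂ)) =
      ((√(1 - ξ ^ 2) * √(1 - μ * ξ ^ 2 / (lam + 2 * μ)) - (1 - ξ ^ 2 / 2) ^ 2 : ℝ) : ℂ) := by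
  have hI : (Complex.I * (ξ : ℂ)) ^ 2 = -(ξ : ℂ) ^ 2 := by
    rw [mul_pow, Complex.I_sq, neg_one_mul]
  have ha : 1 + -(ξ : ℂ) ^ 2 = ((1 - ξ ^ 2 : ℝ) : ℂ) := by
    push_cast
    ring
  have hb : 1 + (μ : ℂ) * -(ξ : ℂ) ^ 2 / ((lam : ℂ) + 2 * (μ : ℂ)) =
      ((1 - μ * ξ ^ 2 / (lam + 2 * μ) : ℝ) : ℂ) := by
    push_cast
    ring
  rw [phi, hI, ha, hb, csqrt_ofReal_of_nonneg hξ, csqrt_ofReal_of_nonneg hξ']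
  push_cast
  ring

/-- Let `μ > 0`, `λ > 0`, `λ̃ = λ/μ`.  For `0 < ξ̃ < 1`,
`φ(iξ̃) = 0 ↔ ψ(ξ̃²) = 0`. -/
theorem phi_zero_iff_psi_zero (μ lam : ℝ) (hμ : 0 < μ) (hlam : 0 < lam)
    (ξ : ℝ) (h0 : 0 < ξ) (h1 : ξ < 1) :
    phi μ lam (Complex.I * (ξ : ℂ)) = 0 ↔ psi (lam / μ) (ξ ^ 2) = 0 := by
  have hξ : ξ ^ 2 < 1 := by nlinarith
  have ha : 0 ≤ 1 - ξ ^ 2 := by linarith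
  have hb : 0 ≤ 1 - μ * ξ ^ 2 / (lam + 2 * μ) := by
    rw [sub_nonneg, div_le_one (by positivity)]
    nlinarith
  have hquot : ξ ^ 2 / (2 + lam / μ) = μ * ξ ^ 2 / (lam + 2 * μ) := by
    field_simp
    ring
  rw [phi_I_mul_ofReal ha hb, Complex.ofReal_eq_zero, sub_eq_zero, psi, sub_eq_zero, hquot,
    ← sq_eq_sq₀ (by positivity) (by positivity), mul_pow, Real.sq_sqrt ha, Real.sq_sqrt hb,
    ← pow_mul]
end

section
/- Let μ > 0, λ > 0, let ξ̃₀ be real with 0 < ξ̃₀ < 1 and φ(iξ̃₀) = 0, let ω > 0 be real, and set κ₁₀ = ω√(1−ξ̃₀²), κ₂₀ = ω√(1−μξ̃₀²/(λ+2μ)), ξ₀ = √μ·ω·ξ̃₀, γ² = λ/(2μ+λ). Define the complex-valued functions u(x,y,t) = e^{iξ₀t+iωy−κ₁₀x} + ((ξ̃₀²−2)/2)·e^{iξ₀t+iωy−κ₂₀x} and v(x,y,t) = −(iκ₁₀/ω)·e^{iξ₀t+iωy−κ₁₀x} + ((ξ̃₀²−2)/2)·(−iω/κ₂₀)·e^{iξ₀t+iωy−κ₂₀x}.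 Then u, v satisfy the homogeneous elastic wave equation u_tt = μΔu + (λ+μ)∂_x(u_x+v_y), v_tt = μΔv + (λ+μ)∂_y(u_x+v_y) for all x ≥ 0, y ∈ ℝ, t ∈ ℝ, and the free-surface boundary conditions u_x + γ²v_y = 0 and u_y + v_x = 0 hold at x = 0. -/
/-- Partial derivative in `x`, for functions of `(x, y, t) : ℝ × ℝ × ℝ`. -/
noncomputable def pdx (f : ℝ × ℝ × ℝ → ℂ) : ℝ × ℝ × ℝ → ℂ :=
  fun p => fderiv ℝ f p ((1 : ℝ), (0 : ℝ), (0 : ℝ))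

/-- Partial derivative in `y`. -/
noncomputable def pdy (f : ℝ × ℝ × ℝ → ℂ) : ℝ × ℝ × ℝ → ℂ :=
  fun p => fderiv ℝ f p ((0 : ℝ), (1 : ℝ), (0 : ℝ))

/-- Partial derivative in `t`. -/
noncomputable def pdt (f : ℝ × ℝ × ℝ → ℂ) : ℝ × ℝ × ℝ → ℂ :=
  fun p => fderiv ℝ f p ((0 : ℝ), (0 : ℝ), (1 : ℝ))

/-- Superposition of two plane-wave modes sharing the factor `exp (α t + β y)`, with decay rates
`k₁`, `k₂` in `x` and amplitudes `A`, `B`. -/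
noncomputable def twoMode (α β k₁ k₂ A B : ℂ) : ℝ × ℝ × ℝ → ℂ := fun p =>
  A * Complex.exp (α * (p.2.2 : ℂ) + β * (p.2.1 : ℂ) - k₁ * (p.1 : ℂ))
    + B * Complex.exp (α * (p.2.2 : ℂ) + β * (p.2.1 : ℂ) - k₂ * (p.1 : ℂ))

lemma twoMode_add (α β k₁ k₂ A B A' B' : ℂ) (p : ℝ × ℝ × ℝ) :
    twoMode α β k₁ k₂ A B p + twoMode α β k₁ k₂ A' B' p
      = twoMode α β k₁ k₂ (A + A') (B + B') p := by
  simp only [twoMode]; ring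

lemma mul_twoMode (c α β k₁ k₂ A B : ℂ) (p : ℝ × ℝ × ℝ) :
    c * twoMode α β k₁ k₂ A B p = twoMode α β k₁ k₂ (c * A) (c * B) p := by
  simp only [twoMode]; ring

lemma twoMode_boundary_eq_zero {A B : ℂ} (h : A + B = 0) (α β k₁ k₂ : ℂ) (y t : ℝ) :
    twoMode α β k₁ k₂ A B (0, y, t) = 0 := by
  simp only [twoMode, Complex.ofReal_zero, mul_zero, sub_zero]
  rw [← add_mul, h, zero_mul]

lemma differentiable_twoMode (α β k₁ k₂ A B : ℂ) :
    Differentiable ℝ (twoMode α β k₁ k₂ A B) := by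
  have coord (L : ℝ × ℝ × ℝ →L[ℝ] ℝ) : Differentiable ℝ fun p => (L p : ℂ) :=
    (Complex.ofRealCLM.comp L).differentiable
  have h1 := coord (.fst ℝ ℝ (ℝ × ℝ))
  have h2 := coord (.comp (.fst ℝ ℝ ℝ) (.snd ℝ ℝ (ℝ × ℝ)))
  have h3 := coord (.comp (.snd ℝ ℝ ℝ) (.snd ℝ ℝ (ℝ × ℝ)))
  simp only [ContinuousLinearMap.comp_apply, ContinuousLinearMap.coe_fst',
    ContinuousLinearMap.coe_snd'] at h1 h2 h3
  unfold twoMode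
  fun_prop

/-- The directional derivative of a superposition of two modes. -/
lemma fderiv_twoMode (α β k₁ k₂ A B : ℂ) (p d : ℝ × ℝ × ℝ) :
    fderiv ℝ (twoMode α β k₁ k₂ A B) p d
      = twoMode α β k₁ k₂ ((α * d.2.2 + β * d.2.1 - k₁ * d.1) * A)
          ((α * d.2.2 + β * d.2.1 - k₂ * d.1) * B) p := by
  rw [← (differentiable_twoMode α β k₁ k₂ A B p).lineDeriv_eq_fderiv]
  apply HasDerivAt.deriv
  have coord (a b : ℝ) : HasDerivAt (fun s : ℝ => ((a + s * b : ℝ) : ℂ)) (b : ℂ) 0 := by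
    simpa using (((hasDerivAt_id (0 : ℝ)).mul_const b).const_add a).ofReal_comp
  have mode (k : ℂ) := ((((coord p.2.2 d.2.2).const_mul α).add
    ((coord p.2.1 d.2.1).const_mul β)).sub ((coord p.1 d.1).const_mul k)).cexp
  have h := ((mode k₁).const_mul A).add ((mode k₂).const_mul B)
  convert h using 1
  · funext s
    simp [twoMode]
  · simp [twoMode]
    ring

lemma pdx_twoMode (α β k₁ k₂ A B : ℂ) :
    pdx (twoMode α β k₁ k₂ A B) = twoMode α β k₁ k₂ (-k₁ * A) (-k₂ * B) := by
  funext p; simp [pdx, fderiv_twoMode]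

lemma pdy_twoMode (α β k₁ k₂ A B : ℂ) :
    pdy (twoMode α β k₁ k₂ A B) = twoMode α β k₁ k₂ (β * A) (β * B) := by
  funext p; simp [pdy, fderiv_twoMode]

lemma pdt_twoMode (α β k₁ k₂ A B : ℂ) :
    pdt (twoMode α β k₁ k₂ A B) = twoMode α β k₁ k₂ (α * A) (α * B) := by
  funext p; simp [pdt, fderiv_twoMode]

lemma csqrt_ofReal {x : ℝ} (hx : 0 ≤ x) : csqrt (x : ℂ) = (Real.sqrt x : ℂ) := by
  rw [csqrt, Real.sqrt_eq_rpow, Complex.ofReal_cpow hx]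
  norm_num

/-- On the imaginary axis below the shear threshold, a root of `phi` satisfies the real Rayleigh
equation. -/
lemma sqrt_mul_sqrt_of_phi_eq_zero {μ lam ξ : ℝ} (h1 : 0 ≤ 1 - ξ ^ 2)
    (h2 : 0 ≤ 1 - μ * ξ ^ 2 / (lam + 2 * μ)) (h : phi μ lam (Complex.I * (ξ : ℂ)) = 0) :
    Real.sqrt (1 - ξ ^ 2) * Real.sqrt (1 - μ * ξ ^ 2 / (lam + 2 * μ))
      = ((ξ ^ 2 - 2) / 2) ^ 2 := by
  have e1 : 1 + (Complex.I * (ξ : ℂ)) ^ 2 = ((1 - ξ ^ 2 : ℝ) : ℂ) := by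
    rw [mul_pow, Complex.I_sq]; push_cast; ring
  have e2 : 1 + (μ : ℂ) * (Complex.I * (ξ : ℂ)) ^ 2 / ((lam : ℂ) + 2 * (μ : ℂ))
      = ((1 - μ * ξ ^ 2 / (lam + 2 * μ) : ℝ) : ℂ) := by
    rw [mul_pow, Complex.I_sq]; push_cast; ring
  rw [phi, e1, e2, csqrt_ofReal h1, csqrt_ofReal h2, mul_pow, Complex.I_sq, sub_eq_zero] at h
  have h' : Real.sqrt (1 - ξ ^ 2) * Real.sqrt (1 - μ * ξ ^ 2 / (lam + 2 * μ))
      = (1 + -1 * ξ ^ 2 / 2) ^ 2 := by exact_mod_cast h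
  rw [h']; ring

/-- The eigenfunction corresponding to the generalized eigenvalue `s₀ = iξ₀`
(a Rayleigh surface wave) satisfies the homogeneous elastic wave equation for
`x ≥ 0` and the free-surface boundary conditions at `x = 0`. -/
theorem generalized_eigenfunction_solves_elastic_equation
    (μ lam : ℝ) (hμ : 0 < μ) (hlam : 0 < lam)
    (ξ₀ : ℝ) (h0 : 0 < ξ₀) (h1 : ξ₀ < 1)
    (hroot : phi μ lam (Complex.I * (ξ₀ : ℂ)) = 0)
    (ω : ℝ) (hω : 0 < ω)
    (u v : ℝ × ℝ × ℝ → ℂ)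
    (hu : u = fun p =>
      Complex.exp (Complex.I * ((Real.sqrt μ * ω * ξ₀ : ℝ) : ℂ) * (p.2.2 : ℂ)
          + Complex.I * (ω : ℂ) * (p.2.1 : ℂ)
          - ((ω * Real.sqrt (1 - ξ₀ ^ 2) : ℝ) : ℂ) * (p.1 : ℂ))
      + (((ξ₀ ^ 2 - 2) / 2 : ℝ) : ℂ) *
        Complex.exp (Complex.I * ((Real.sqrt μ * ω * ξ₀ : ℝ) : ℂ) * (p.2.2 : ℂ)
          + Complex.I * (ω : ℂ) * (p.2.1 : ℂ)
          - ((ω * Real.sqrt (1 - μ * ξ₀ ^ 2 / (lam + 2 * μ)) : ℝ) : ℂ) * (p.1 : ℂ)))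
    (hv : v = fun p =>
      -(Complex.I * ((ω * Real.sqrt (1 - ξ₀ ^ 2) : ℝ) : ℂ) / (ω : ℂ)) *
        Complex.exp (Complex.I * ((Real.sqrt μ * ω * ξ₀ : ℝ) : ℂ) * (p.2.2 : ℂ)
          + Complex.I * (ω : ℂ) * (p.2.1 : ℂ)
          - ((ω * Real.sqrt (1 - ξ₀ ^ 2) : ℝ) : ℂ) * (p.1 : ℂ))
      + (((ξ₀ ^ 2 - 2) / 2 : ℝ) : ℂ) *
        (-(Complex.I * (ω : ℂ)) / ((ω * Real.sqrt (1 - μ * ξ₀ ^ 2 / (lam + 2 * μ)) : ℝ) : ℂ)) *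
        Complex.exp (Complex.I * ((Real.sqrt μ * ω * ξ₀ : ℝ) : ℂ) * (p.2.2 : ℂ)
          + Complex.I * (ω : ℂ) * (p.2.1 : ℂ)
          - ((ω * Real.sqrt (1 - μ * ξ₀ ^ 2 / (lam + 2 * μ)) : ℝ) : ℂ) * (p.1 : ℂ))) :
    (∀ p : ℝ × ℝ × ℝ, 0 ≤ p.1 →
      pdt (pdt u) p = (μ : ℂ) * (pdx (pdx u) p + pdy (pdy u) p)
          + ((lam : ℂ) + (μ : ℂ)) * pdx (fun q => pdx u q + pdy v q) p ∧
      pdt (pdt v) p = (μ : ℂ) * (pdx (pdx v) p + pdy (pdy v) p)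
          + ((lam : ℂ) + (μ : ℂ)) * pdy (fun q => pdx u q + pdy v q) p) ∧
    (∀ y t : ℝ,
      pdx u (0, y, t) + ((lam : ℂ) / (2 * (μ : ℂ) + (lam : ℂ))) * pdy v (0, y, t) = 0 ∧
      pdy u (0, y, t) + pdx v (0, y, t) = 0) := by
  have hD : 0 < lam + 2 * μ := by linarith
  have hξ : ξ₀ ^ 2 < 1 := by nlinarith
  have h1' : 0 ≤ 1 - ξ₀ ^ 2 := by linarith
  have h2' : 0 < 1 - μ * ξ₀ ^ 2 / (lam + 2 * μ) := by
    rw [sub_pos, div_lt_one hD]; nlinarith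
  have hab := sqrt_mul_sqrt_of_phi_eq_zero h1' h2'.le hroot
  have ha := Real.sq_sqrt h1'
  have hb := Real.sq_sqrt h2'.le
  have hb0 := Real.sqrt_pos.2 h2'
  have hm := Real.sq_sqrt hμ.le
  generalize Real.sqrt (1 - ξ₀ ^ 2) = a at *
  generalize Real.sqrt (1 - μ * ξ₀ ^ 2 / (lam + 2 * μ)) = b at *
  generalize Real.sqrt μ = m at *
  have hb' : (lam + 2 * μ) * b ^ 2 = lam + 2 * μ - μ * ξ₀ ^ 2 := by
    rw [hb]; field_simp
  have hDC : (2 * (μ : ℂ) + (lam : ℂ)) ≠ 0 := by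
    exact_mod_cast (by linarith : (0 : ℝ) < 2 * μ + lam).ne'
  have hωC : (ω : ℂ) ≠ 0 := by exact_mod_cast hω.ne'
  have hbC : (b : ℂ) ≠ 0 := by exact_mod_cast hb0.ne'
  have habC : (a : ℂ) * b = (((ξ₀ : ℂ) ^ 2 - 2) / 2) ^ 2 := by exact_mod_cast hab
  have haC : (a : ℂ) ^ 2 = 1 - (ξ₀ : ℂ) ^ 2 := by exact_mod_cast ha
  have hbC' : ((lam : ℂ) + 2 * μ) * (b : ℂ) ^ 2 = lam + 2 * μ - μ * (ξ₀ : ℂ) ^ 2 := by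
    exact_mod_cast hb'
  have hmC : (m : ℂ) ^ 2 = μ := by exact_mod_cast hm
  have hu' : u = twoMode (Complex.I * (m * ω * ξ₀)) (Complex.I * ω) (ω * a) (ω * b)
      1 ((ξ₀ ^ 2 - 2) / 2) := by
    rw [hu]; funext p; simp [twoMode]
  have hv' : v = twoMode (Complex.I * (m * ω * ξ₀)) (Complex.I * ω) (ω * a) (ω * b)
      (-(Complex.I * a)) ((ξ₀ ^ 2 - 2) / 2 * (-Complex.I / b)) := by
    have e1 : -(Complex.I * (ω * a) / ω) = -(Complex.I * a) := by field_simp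
    have e2 : -(Complex.I * ω) / (ω * b) = -Complex.I / b := by field_simp
    rw [hv]; funext p; simp only [twoMode]; push_cast; rw [e1, e2]
  clear hu hv
  subst hu' hv'
  simp only [pdx_twoMode, pdy_twoMode, pdt_twoMode, twoMode_add, mul_twoMode]
  have hI := Complex.I_sq
  have hw : (b : ℂ)⁻¹ * b = 1 := inv_mul_cancel₀ hbC
  simp only [div_eq_mul_inv (-Complex.I)]
  generalize (b : ℂ)⁻¹ = w at *
  obtain ⟨c, hc⟩ : ∃ c : ℂ, c = ((ξ₀ : ℂ) ^ 2 - 2) / 2 := ⟨_, rfl⟩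
  rw [← hc] at habC ⊢
  refine ⟨fun p _ => ⟨?_, ?_⟩, fun y t => ⟨?_, ?_⟩⟩
  · congr 1
    · linear_combination (m ^ 2 * ω ^ 2 * ξ₀ ^ 2 - μ * ω ^ 2 - (lam + μ) * ω ^ 2 * a ^ 2) * hI
        - ω ^ 2 * ξ₀ ^ 2 * hmC - μ * ω ^ 2 * haC
    · linear_combination c * (m ^ 2 * ω ^ 2 * ξ₀ ^ 2 - μ * ω ^ 2 - (lam + μ) * ω ^ 2) * hI
        - c * ω ^ 2 * ξ₀ ^ 2 * hmC - c * ω ^ 2 * hbC'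
        - (lam + μ) * c * ω ^ 2 * Complex.I ^ 2 * hw
  · congr 1
    · linear_combination
        (-Complex.I * a * (m ^ 2 * ω ^ 2 * ξ₀ ^ 2 - μ * ω ^ 2)
          + (lam + μ) * Complex.I * ω ^ 2 * a) * hI
        + Complex.I * a * ω ^ 2 * ξ₀ ^ 2 * hmC + Complex.I * a * μ * ω ^ 2 * haC
    · linear_combination
        -c * Complex.I * w * (m ^ 2 * ω ^ 2 * ξ₀ ^ 2 - (lam + 2 * μ) * ω ^ 2) * hI
        + c * Complex.I * w * ω ^ 2 * ξ₀ ^ 2 * hmC + c * Complex.I * w * ω ^ 2 * hbC'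
        - (lam + μ) * Complex.I * ω ^ 2 * c * b * hw
  · apply twoMode_boundary_eq_zero
    have hg : (lam : ℂ) / (2 * μ + lam) * (2 * μ + lam) = lam := div_mul_cancel₀ _ hDC
    generalize (lam : ℂ) / (2 * μ + lam) = g at *
    apply mul_left_cancel₀ hDC
    linear_combination lam * (-ω * a - c * ω * w) * hI
      + (c * ω * (2 * μ + lam) * b + 2 * μ * ω * a) * hw - c * ω * w * hbC'
      - 2 * μ * ω * w * habC - Complex.I ^ 2 * ω * (a + c * w) * hg
      - 2 * μ * c * ω * w * hc
  · apply twoMode_boundary_eq_zero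
    linear_combination Complex.I * ω * c * hw + Complex.I * ω * haC + 2 * Complex.I * ω * hc
end
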